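/- Assume 4 divides q−1, let η be the quadratic character of κ and let σ be a multiplicative character of κ of exact order 4 (so σ² = η). Then for every λ ∈ κ with λ ≠ 0 and λ ≠ 1: −∑_{x∈κ} η((1−x)·(1−λ·x²)) = σ̄(−λ) · F(σ, σ; ε; 1−λ). (The left-hand side is the trace of Frobenius a(E_λ) = 1 + q − #E_λ(κ) of the elliptic curve E_λ : y² = (1−x)(1−λx²) over κ.) -/

import Mathlib

/-!
Finite-field hypergeometric functions (Otsubo), basic definitions:
`κ` is a finite field with `q = Fintype.card κ` elements, `ψ` a fixed nontrivial
additive character, multiplicative characters are `MulChar κ ℂ` (extended by `0`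
on `0`, with trivial character `1`).
-/

open scoped Classical

noncomputable section

variable {κ : Type*} [Field κ] [Fintype κ]

instance : Fintype (MulChar κ ℂ) := Fintype.ofFinite _

/-- The Gauss sum `g(φ) = -∑_{x ∈ κ} ψ(x) φ(x)`. -/
def gS (ψ : AddChar κ ℂ) (φ : MulChar κ ℂ) : ℂ := -∑ x : κ, ψ x * φ x

/-- The variant `g°(φ) = q^{δ(φ)} · g(φ)`, where `δ(φ) = 1` iff `φ` is trivial. -/
def gSo (ψ : AddChar κ ℂ) (φ : MulChar κ ℂ) : ℂ :=
  (if φ = 1 then (Fintype.card κ : ℂ) else 1) * gS ψ φ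

/-- The Pochhammer symbol `(α)_ν = g(αν)/g(α)`. -/
def poch (ψ : AddChar κ ℂ) (α ν : MulChar κ ℂ) : ℂ := gS ψ (α * ν) / gS ψ α

/-- The variant Pochhammer symbol `(α)°_ν = g°(αν)/g°(α)`. -/
def pocho (ψ : AddChar κ ℂ) (α ν : MulChar κ ℂ) : ℂ := gSo ψ (α * ν) / gSo ψ α

/-- The finite hypergeometric function
`F(α₁,…,α_r; β₁,…,β_s; λ) = (1/(1-q)) ∑_ν ((α₁)_ν ⋯ (α_r)_ν / ((ε)°_ν (β₁)°_ν ⋯ (β_s)°_ν)) ν(λ)`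
(the trivial character `ε = 1` appears implicitly among the lower parameters). -/
def Fh (ψ : AddChar κ ℂ) {r s : ℕ} (A : Fin r → MulChar κ ℂ) (B : Fin s → MulChar κ ℂ)
    (l : κ) : ℂ :=
  (1 - (Fintype.card κ : ℂ))⁻¹ *
    ∑ ν : MulChar κ ℂ,
      ((∏ i, poch ψ (A i) ν) / (pocho ψ 1 ν * ∏ j, pocho ψ (B j) ν)) * ν l

lemma sum_mulChar_apply (y : κ) :
    ∑ ν : MulChar κ ℂ, ν y = if y = 1 then (Fintype.card κ : ℂ) - 1 else 0 := by
  split_ifs with hy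
  · subst hy
    have h := MulChar.card_eq_card_units_of_hasEnoughRootsOfUnity κ ℂ
    have h2 := Fintype.card_eq_card_units_add_one (α := κ)
    rw [Nat.card_eq_fintype_card, Nat.card_eq_fintype_card] at h
    simp [h, h2]
  · by_cases hy0 : y = 0
    · subst hy0
      simp [MulChar.map_zero]
    · obtain ⟨χ, hχ⟩ := MulChar.exists_apply_ne_one_of_hasEnoughRootsOfUnity κ ℂ hy
      refine eq_zero_of_mul_eq_self_left hχ ?_
      simp only [Finset.mul_sum, ← MulChar.mul_apply]
      exact (Group.mulLeft_bijective χ).sum_comp (fun ν : MulChar κ ℂ => ν y)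

lemma gS_eq_neg_gaussSum (ψ : AddChar κ ℂ) (φ : MulChar κ ℂ) : gS ψ φ = -gaussSum φ ψ := by
  simp [gS, gaussSum, mul_comm]

lemma card_ne_zero_complex : (Fintype.card κ : ℂ) ≠ 0 := by
  exact_mod_cast Fintype.card_ne_zero

lemma gS_one {ψ : AddChar κ ℂ} (hψ : ψ ≠ 1) : gS ψ 1 = 1 := by
  rw [gS_eq_neg_gaussSum, gaussSum_one_left hψ, neg_neg]

lemma gS_ne_zero {ψ : AddChar κ ℂ} (hψ : ψ ≠ 1) {φ : MulChar κ ℂ} (hφ : φ ≠ 1) :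
    gS ψ φ ≠ 0 := by
  rw [gS_eq_neg_gaussSum, neg_ne_zero]
  exact gaussSum_ne_zero_of_nontrivial card_ne_zero_complex hφ (AddChar.IsPrimitive.of_ne_one hψ)

lemma inv_pocho_one {ψ : AddChar κ ℂ} (hψ : ψ ≠ 1) (ν : MulChar κ ℂ) :
    (pocho ψ 1 ν)⁻¹ = ν (-1) * gS ψ ν⁻¹ := by
  have hq := card_ne_zero_complex (κ := κ)
  by_cases hν : ν = 1
  · subst hν
    have h1 : (1 : MulChar κ ℂ) (-1) = 1 := MulChar.one_apply isUnit_one.neg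
    simp [pocho, gSo, gS_one hψ, h1, hq]
  · have h := gaussSum_mul_gaussSum_eq_card hν (AddChar.IsPrimitive.of_ne_one hψ)
    have h' := mul_gaussSum_inv_eq_gaussSum ν⁻¹ ψ
    have h1 : ν⁻¹ (-1) = ν (-1) := by rw [MulChar.inv_apply', inv_neg_one]
    have h2 : ν (-1) * ν (-1) = 1 := by rw [← map_mul]; simp
    have hne := gS_ne_zero hψ hν
    simp only [pocho, gSo, one_mul, hν, if_false, if_true, gS_one hψ, mul_one, inv_div]
    rw [div_eq_iff hne, gS_eq_neg_gaussSum, gS_eq_neg_gaussSum, ← h', h1, ← h]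
    linear_combination (-(gaussSum ν ψ * gaussSum ν⁻¹ ψ⁻¹)) * h2

lemma poch_div_pocho_one {ψ : AddChar κ ℂ} (hψ : ψ ≠ 1) {α : MulChar κ ℂ} (hα : α ≠ 1)
    (ν : MulChar κ ℂ) :
    poch ψ α ν / pocho ψ 1 ν = -(ν (-1) * jacobiSum (α * ν) ν⁻¹) := by
  have h : gaussSum α ψ * jacobiSum (α * ν) ν⁻¹ = gaussSum (α * ν) ψ * gaussSum ν⁻¹ ψ := by
    have h0 : α * ν * ν⁻¹ = α := mul_inv_cancel_right α ν
    have := jacobiSum_mul_nontrivial (χ := α * ν) (φ := ν⁻¹) (by rwa [h0]) ψ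
    rwa [h0] at this
  have hne := gS_ne_zero hψ hα
  rw [div_eq_mul_inv, inv_pocho_one hψ, poch, div_mul_eq_mul_div, div_eq_iff hne]
  simp only [gS_eq_neg_gaussSum]
  linear_combination (-ν (-1)) * h

/-- Euler-type integral representation of `F(α, α; ε; x)`. -/
lemma Fh_eq_neg_sum {ψ : AddChar κ ℂ} (hψ : ψ ≠ 1) {α : MulChar κ ℂ} (hα : α ≠ 1)
    {x : κ} (hx : x ≠ 0) :
    Fh ψ ![α, α] ![1] x = -∑ s : κ, α s * α (1 - s) * α⁻¹ (1 - (1 - x) * s) := by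
  have hterm : ∀ ν : MulChar κ ℂ,
      ((∏ i, poch ψ ((![α, α] : Fin 2 → MulChar κ ℂ) i) ν) /
        (pocho ψ 1 ν * ∏ j, pocho ψ ((![1] : Fin 1 → MulChar κ ℂ) j) ν)) * ν x =
      ∑ s : κ, ∑ t : κ, α s * α t * ν (s * t * x * (1 - s)⁻¹ * (1 - t)⁻¹) := by
    intro ν
    have h2 : ν (-1) * ν (-1) = 1 := by rw [← map_mul]; simp
    have h3 : ((∏ i, poch ψ ((![α, α] : Fin 2 → MulChar κ ℂ) i) ν) /
        (pocho ψ 1 ν * ∏ j, pocho ψ ((![1] : Fin 1 → MulChar κ ℂ) j) ν)) =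
        jacobiSum (α * ν) ν⁻¹ * jacobiSum (α * ν) ν⁻¹ := by
      simp only [Fin.prod_univ_two, Fin.prod_univ_one, Matrix.cons_val_zero, Matrix.cons_val_one]
      rw [mul_div_mul_comm, poch_div_pocho_one hψ hα]
      linear_combination (jacobiSum (α * ν) ν⁻¹ * jacobiSum (α * ν) ν⁻¹) * h2
    rw [h3, jacobiSum, Finset.sum_mul_sum, Finset.sum_mul]
    refine Finset.sum_congr rfl fun s _ => ?_
    rw [Finset.sum_mul]
    refine Finset.sum_congr rfl fun t _ => ?_
    simp only [MulChar.mul_apply, MulChar.inv_apply', map_mul]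
    ring
  have hinner : ∀ s : κ, ∑ t : κ, α s * α t *
        (if s * t * x * (1 - s)⁻¹ * (1 - t)⁻¹ = 1 then (Fintype.card κ : ℂ) - 1 else 0) =
      ((Fintype.card κ : ℂ) - 1) * (α s * α (1 - s) * α⁻¹ (1 - (1 - x) * s)) := by
    intro s
    by_cases hs0 : s = 0
    · simp [hs0, MulChar.map_zero]
    by_cases hs1 : 1 - s = 0
    · simp [hs1, MulChar.map_zero]
    have hiff : ∀ t : κ, s * t * x * (1 - s)⁻¹ * (1 - t)⁻¹ = 1 ↔
        t * (1 - (1 - x) * s) = 1 - s := by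
      intro t
      by_cases ht : 1 - t = 0
      · have ht1 : t = 1 := (sub_eq_zero.mp ht).symm
        subst ht1
        simp only [sub_self, inv_zero, mul_zero, zero_ne_one, false_iff]
        intro h
        exact mul_ne_zero hx hs0 (by linear_combination h)
      · rw [← div_eq_mul_inv, ← div_eq_mul_inv, div_div, div_eq_one_iff_eq (mul_ne_zero hs1 ht)]
        constructor <;> intro h <;> linear_combination h
    simp only [hiff]
    by_cases hd : 1 - (1 - x) * s = 0
    · simp [hd, Ne.symm hs1, MulChar.map_zero]
    · simp only [← eq_div_iff hd, mul_ite, mul_zero, Finset.sum_ite_eq', Finset.mem_univ, if_true,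
        div_eq_mul_inv, map_mul, MulChar.inv_apply']
      ring
  have hq1 : (1 : ℂ) - Fintype.card κ ≠ 0 := by
    rw [sub_ne_zero]
    exact_mod_cast (Fintype.one_lt_card (α := κ)).ne
  rw [Fh, Finset.sum_congr rfl fun ν _ => hterm ν, Finset.sum_comm]
  have : ∀ s : κ, ∑ ν : MulChar κ ℂ, ∑ t : κ,
      α s * α t * ν (s * t * x * (1 - s)⁻¹ * (1 - t)⁻¹) =
      ((Fintype.card κ : ℂ) - 1) * (α s * α (1 - s) * α⁻¹ (1 - (1 - x) * s)) := by
    intro s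
    rw [Finset.sum_comm, ← hinner s]
    refine Finset.sum_congr rfl fun t _ => ?_
    rw [← Finset.mul_sum, sum_mulChar_apply]
  rw [Finset.sum_congr rfl fun s _ => this s, ← Finset.mul_sum, inv_mul_eq_iff_eq_mul₀ hq1]
  ring

lemma mulChar_eq_quadraticChar (h2 : ringChar κ ≠ 2) {η : MulChar κ ℂ} (hη2 : η ^ 2 = 1)
    (hη1 : η ≠ 1) : η = (quadraticChar κ).ringHomComp (Int.castRingHom ℂ) := by
  obtain ⟨g, hg⟩ := IsCyclic.exists_generator (α := κˣ)
  have key : ∀ χ : MulChar κ ℂ, χ ^ 2 = 1 → χ ≠ 1 → χ g = -1 := by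
    intro χ hχ2 hχ1
    have h : χ g ^ 2 = 1 := by
      rw [← MulChar.pow_apply_coe, hχ2, MulChar.one_apply_coe]
    have h' : χ g ≠ 1 := by
      rw [Ne, MulChar.eq_iff hg, MulChar.one_apply_coe] at hχ1
      exact hχ1
    exact (mul_self_eq_one_iff.mp (by rw [← sq, h])).resolve_left h'
  rw [MulChar.eq_iff hg, key η hη2 hη1, key]
  · exact ((quadraticChar_isQuadratic κ).comp _).sq_eq_one
  · rw [Ne, MulChar.ringHomComp_eq_one_iff (RingHom.injective_int _)]
    exact quadraticChar_ne_one h2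

lemma sum_sq_eq_ite (h2 : ringChar κ ≠ 2) {η : MulChar κ ℂ} (hη2 : η ^ 2 = 1) (hη1 : η ≠ 1)
    (a : κ) : ∑ u : κ, (if u ^ 2 = a then (1 : ℂ) else 0) = 1 + η a := by
  have h := quadraticChar_card_sqrts h2 a
  rw [mulChar_eq_quadraticChar h2 hη2 hη1, Finset.sum_boole]
  have h' := congrArg (Int.cast : ℤ → ℂ) h
  push_cast at h'
  rw [MulChar.ringHomComp_apply, eq_intCast, add_comm, ← h']
  congr 2
  ext u
  simp

lemma sum_comp_sq (h2 : ringChar κ ≠ 2) {η : MulChar κ ℂ} (hη2 : η ^ 2 = 1) (hη1 : η ≠ 1)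
    (f : κ → ℂ) : ∑ u : κ, f (u ^ 2) = ∑ a : κ, (1 + η a) * f a := by
  simp only [← sum_sq_eq_ite h2 hη2 hη1, Finset.sum_mul]
  rw [Finset.sum_comm]
  simp

lemma sum_quadratic_roots (h2 : ringChar κ ≠ 2) {η : MulChar κ ℂ} (hη2 : η ^ 2 = 1)
    (hη1 : η ≠ 1) (b c : κ) :
    ∑ u : κ, (if u ^ 2 - b * u + c = 0 then (1 : ℂ) else 0) = 1 + η (b ^ 2 - 4 * c) := by
  have h20 := Ring.two_ne_zero h2
  rw [← sum_sq_eq_ite h2 hη2 hη1]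
  refine Fintype.sum_bijective (fun u : κ => 2 * u - b)
    ((Equiv.mulLeft₀ (2 : κ) h20).trans (Equiv.subRight b)).bijective _ _ fun u => ?_
  have : (2 * u - b) ^ 2 = b ^ 2 - 4 * c ↔ u ^ 2 - b * u + c = 0 := by
    constructor
    · intro h
      have : (2 * 2 : κ) * (u ^ 2 - b * u + c) = 0 := by linear_combination h
      exact (mul_eq_zero.mp this).resolve_left (mul_ne_zero h20 h20)
    · intro h
      linear_combination 4 * h
  simp only [this]

lemma sum_quartic_eq (h2 : ringChar κ ≠ 2) {η σ : MulChar κ ℂ} (hη2 : η ^ 2 = 1)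
    (hη1 : η ≠ 1) (hσ1 : σ ≠ 1) {l : κ} (hl1 : l ≠ 1) :
    ∑ u : κ, σ u * σ (1 - u) * σ⁻¹ (1 - l * u) =
      ∑ w : κ, σ w * η ((1 + l * w) ^ 2 - 4 * w) := by
  have h : ∀ w : κ, σ w + σ w * η ((1 + l * w) ^ 2 - 4 * w) =
      ∑ u : κ, if u ^ 2 - (1 + l * w) * u + w = 0 then σ w else 0 := by
    intro w
    have := sum_quadratic_roots h2 hη2 hη1 (1 + l * w) w
    rw [← mul_one_add, ← this, Finset.mul_sum]
    simp
  have h' := Finset.sum_congr rfl fun (w : κ) (_ : w ∈ Finset.univ) => h w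
  rw [Finset.sum_add_distrib, MulChar.sum_eq_zero_of_ne_one hσ1, zero_add] at h'
  rw [h', Finset.sum_comm]
  refine Finset.sum_congr rfl fun u _ => ?_
  by_cases hd : 1 - l * u = 0
  · have hne : ∀ w : κ, u ^ 2 - (1 + l * w) * u + w ≠ 0 := by
      intro w hw
      have h0 : u * (u - 1) = 0 := by linear_combination hw - w * hd
      rcases mul_eq_zero.mp h0 with hu | hu
      · simp [hu] at hd
      · rw [sub_eq_zero.mp hu] at hd
        exact hl1 (by linear_combination -hd)
    simp [hne, hd, MulChar.map_zero]
  · have hiff : ∀ w : κ, u ^ 2 - (1 + l * w) * u + w = 0 ↔ w = u * (1 - u) / (1 - l * u) := by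
      intro w
      rw [eq_div_iff hd]
      constructor <;> intro h <;> linear_combination h
    simp [hiff, div_eq_mul_inv, MulChar.inv_apply']

lemma apply_sq_eq_one {F : Type*} [Field F] {η : MulChar F ℂ} (hη2 : η ^ 2 = 1) {a : F} (ha : a ≠ 0) :
    η (a ^ 2) = 1 := by
  rw [map_pow, ← MulChar.pow_apply' η two_ne_zero, hη2, MulChar.one_apply ha.isUnit]

lemma sum_quadratic_roots_mul (h2 : ringChar κ ≠ 2) {η : MulChar κ ℂ} (hη2 : η ^ 2 = 1)
    (hη1 : η ≠ 1) (hneg : η (-1) = 1) (x : κ) :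
    ∑ s : κ, (if s ^ 2 - 2 * x * s + 1 = 0 then η s else 0) =
      η (2 * (x + 1)) + η (2 * (x - 1)) := by
  have h20 := Ring.two_ne_zero h2
  have h4 : η 4 = 1 := by
    rw [show (4 : κ) = 2 ^ 2 by norm_num]
    exact apply_sq_eq_one hη2 h20
  by_cases hx : x = -1
  · subst hx
    have hiff : ∀ s : κ, s ^ 2 - 2 * (-1) * s + 1 = 0 ↔ s = -1 := by
      intro s
      rw [show s ^ 2 - 2 * (-1) * s + 1 = (s + 1) ^ 2 by ring, sq_eq_zero_iff,
        eq_neg_iff_add_eq_zero]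
    simp only [hiff, Finset.sum_ite_eq', Finset.mem_univ, if_true, hneg]
    rw [show (2 : κ) * (-1 + 1) = 0 by ring, show (2 : κ) * (-1 - 1) = -1 * 4 by ring, map_mul,
      h4, hneg, MulChar.map_zero]
    ring
  · have hx0 : x + 1 ≠ 0 := fun h => hx (eq_neg_of_add_eq_zero_left h)
    have hs : ∀ s : κ, (if s ^ 2 - 2 * x * s + 1 = 0 then η s else 0) =
        η (2 * (x + 1)) * (if s ^ 2 - 2 * x * s + 1 = 0 then 1 else 0) := by
      intro s
      split_ifs with h
      · have hs0 : s ≠ 0 := by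
          rintro rfl
          simp at h
        have e : s * (2 * (x + 1)) = (s + 1) ^ 2 := by linear_combination -h
        have hs1 : s + 1 ≠ 0 := by
          intro h0
          rw [h0] at e
          exact mul_ne_zero hs0 (mul_ne_zero h20 hx0) (by simpa using e)
        have e1 : η s * η (2 * (x + 1)) = 1 := by
          rw [← map_mul, e, apply_sq_eq_one hη2 hs1]
        have e2 : η s * η s = 1 := by
          rw [← map_mul, ← sq, apply_sq_eq_one hη2 hs0]
        linear_combination η (2 * (x + 1)) * e2 - η s * e1
      · simp
    rw [Finset.sum_congr rfl fun s _ => hs s, ← Finset.mul_sum, sum_quadratic_roots h2 hη2 hη1,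
      mul_one_add, ← map_mul,
      show 2 * (x + 1) * ((2 * x) ^ 2 - 4 * 1) = (2 * (x + 1)) ^ 2 * (2 * (x - 1)) by ring,
      map_mul η ((2 * (x + 1)) ^ 2), apply_sq_eq_one hη2 (mul_ne_zero h20 hx0), one_mul]

lemma sum_joukowski (h2 : ringChar κ ≠ 2) {η : MulChar κ ℂ} (hη2 : η ^ 2 = 1)
    (hη1 : η ≠ 1) (hneg : η (-1) = 1) (l : κ) :
    ∑ s : κ, η s * η (l * (1 + s ^ 2) ^ 2 - 4 * s ^ 2) =
      2 * η 2 * ∑ x : κ, η ((1 - x) * (1 - l * x ^ 2)) := by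
  have h20 := Ring.two_ne_zero h2
  have hs : ∀ s : κ, η s * η (l * (1 + s ^ 2) ^ 2 - 4 * s ^ 2) =
      ∑ x : κ, (if s ^ 2 - 2 * x * s + 1 = 0 then η s else 0) * η (1 - l * x ^ 2) := by
    intro s
    by_cases hs0 : s = 0
    · simp [hs0, MulChar.map_zero]
    have hd : 2 * s ≠ 0 := mul_ne_zero h20 hs0
    have hiff : ∀ x : κ, s ^ 2 - 2 * x * s + 1 = 0 ↔ x = (1 + s ^ 2) / (2 * s) := by
      intro x
      rw [eq_div_iff hd]
      constructor <;> intro h <;> linear_combination -h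
    simp only [hiff, ite_mul, zero_mul, Finset.sum_ite_eq', Finset.mem_univ, if_true]
    have e : l * (1 + s ^ 2) ^ 2 - 4 * s ^ 2 =
        (-1) * (2 * s) ^ 2 * (1 - l * ((1 + s ^ 2) / (2 * s)) ^ 2) := by
      field_simp
      ring
    rw [e, map_mul, map_mul η (-1), hneg, apply_sq_eq_one hη2 hd, one_mul, one_mul]
  rw [Finset.sum_congr rfl fun s _ => hs s, Finset.sum_comm]
  simp only [← Finset.sum_mul, sum_quadratic_roots_mul h2 hη2 hη1 hneg, add_mul,
    Finset.sum_add_distrib]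
  have e1 : ∑ x : κ, η (2 * (x + 1)) * η (1 - l * x ^ 2) =
      η 2 * ∑ x : κ, η ((1 - x) * (1 - l * x ^ 2)) := by
    rw [Finset.mul_sum]
    refine Fintype.sum_equiv (Equiv.neg κ) _ _ fun x => ?_
    simp only [Equiv.neg_apply, neg_sq, sub_neg_eq_add, map_mul, add_comm x, mul_assoc]
  have e2 : ∑ x : κ, η (2 * (x - 1)) * η (1 - l * x ^ 2) =
      η 2 * ∑ x : κ, η ((1 - x) * (1 - l * x ^ 2)) := by
    rw [Finset.mul_sum]
    refine Finset.sum_congr rfl fun x _ => ?_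
    rw [show 2 * (x - 1) = 2 * ((-1) * (1 - x)) by ring, map_mul, map_mul, hneg, one_mul, map_mul,
      mul_assoc]
  rw [e1, e2]
  ring

lemma two_mul_sum_palindromic (h2 : ringChar κ ≠ 2) {η σ : MulChar κ ℂ} (hη2 : η ^ 2 = 1)
    (hη1 : η ≠ 1) (hση : σ ^ 2 = η) (l : κ) :
    2 * ∑ v : κ, σ v * η (l * (1 - v) ^ 2 + 4 * v) =
      ∑ r : κ, η r * η (l * (1 - r ^ 2) ^ 2 + 4 * r ^ 2) := by
  have hσsq : ∀ v : κ, σ v ^ 2 = η v := fun v => by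
    rw [← hση, MulChar.pow_apply' σ two_ne_zero]
  have h1 : ∑ v : κ, σ v * η (l * (1 - v) ^ 2 + 4 * v) =
      ∑ v : κ, σ v * η v * η (l * (1 - v) ^ 2 + 4 * v) := by
    refine Fintype.sum_equiv (inv_involutive (G := κ)).toPerm _ _ fun v => ?_
    by_cases hv : v = 0
    · simp [hv, MulChar.map_zero]
    simp only [Function.Involutive.coe_toPerm]
    have e : l * (1 - v) ^ 2 + 4 * v = v ^ 2 * (l * (1 - v⁻¹) ^ 2 + 4 * v⁻¹) := by
      field_simp
      ring
    have e1 : σ v⁻¹ * η v⁻¹ = σ v := by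
      have a1 : σ v⁻¹ * σ v = 1 := by rw [← map_mul, inv_mul_cancel₀ hv, map_one]
      have a2 : σ v ^ 2 * σ v ^ 2 = 1 := by
        rw [hσsq, ← map_mul, ← sq, apply_sq_eq_one hη2 hv]
      have a3 : σ v⁻¹ ^ 3 * σ v ^ 3 = 1 := by rw [← mul_pow, a1, one_pow]
      rw [← hσsq]
      linear_combination (-σ v⁻¹ ^ 3) * a2 + σ v * a3
    rw [e, map_mul, apply_sq_eq_one hη2 hv, one_mul, e1]
  have h3 := sum_comp_sq h2 hη2 hη1 fun v => σ v * η (l * (1 - v) ^ 2 + 4 * v)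
  simp only [map_pow σ, hσsq] at h3
  rw [h3, two_mul]
  nth_rw 2 [h1]
  rw [← Finset.sum_add_distrib]
  exact Finset.sum_congr rfl fun v _ => by ring

/-- with `4 ∣ q-1`, `η` the quadratic character and `σ` a quartic character
(`σ` of order 4, `σ² = η`), for `λ ≠ 0,1`:
`-∑_{x∈κ} η((1-x)(1-λx²)) = σ̄(-λ) · F(σ,σ;ε;1-λ)`
(the left side is the Frobenius trace of the elliptic curve `y² = (1-x)(1-λx²)`). -/
theorem stmt_19 (ψ : AddChar κ ℂ) (hψ : ψ ≠ 1)
    (hq : 4 ∣ Fintype.card κ - 1)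
    (η σ : MulChar κ ℂ) (hη2 : η ^ 2 = 1) (hη1 : η ≠ 1)
    (hσ : orderOf σ = 4) (hση : σ ^ 2 = η)
    (l : κ) (hl0 : l ≠ 0) (hl1 : l ≠ 1) :
    -∑ x : κ, η ((1 - x) * (1 - l * x ^ 2)) =
      σ⁻¹ (-l) * Fh ψ ![σ, σ] ![1] (1 - l) := by
  have h2 : ringChar κ ≠ 2 := by
    intro h
    have h' := FiniteField.even_card_of_char_two h
    have h1 := Fintype.one_lt_card (α := κ)
    omega
  have h20 := Ring.two_ne_zero h2
  obtain ⟨i, hi⟩ : ∃ i : κ, i ^ 2 = -1 := by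
    have : IsSquare (-1 : κ) := by
      rw [FiniteField.isSquare_neg_one_iff]
      have h1 := Fintype.one_lt_card (α := κ)
      omega
    obtain ⟨i, hi⟩ := this
    exact ⟨i, by rw [hi, sq]⟩
  have hi0 : i ≠ 0 := by
    rintro rfl
    simp at hi
  have hneg : η (-1) = 1 := by rw [← hi, apply_sq_eq_one hη2 hi0]
  have hi2 : η i * η 2 = 1 := by
    have h1i : 1 + i ≠ 0 := by
      intro h
      exact h20 (by linear_combination (1 - i) * h + hi)
    rw [← map_mul, show i * 2 = (1 + i) ^ 2 by linear_combination -hi, apply_sq_eq_one hη2 h1i]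
  have hσ1 : σ ≠ 1 := by
    rintro rfl
    simp at hσ
  have hσsq : ∀ v : κ, σ v ^ 2 = η v := fun v => by
    rw [← hση, MulChar.pow_apply' σ two_ne_zero]
  have hrot : ∑ r : κ, η r * η (l * (1 - r ^ 2) ^ 2 + 4 * r ^ 2) =
      η i * ∑ s : κ, η s * η (l * (1 + s ^ 2) ^ 2 - 4 * s ^ 2) := by
    rw [Finset.mul_sum]
    refine (Fintype.sum_equiv (Equiv.mulLeft₀ i hi0) _ _ fun s => ?_).symm
    simp only [Equiv.mulLeft₀_apply]
    rw [show (i * s) ^ 2 = -s ^ 2 by rw [mul_pow, hi]; ring, map_mul, mul_assoc]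
    congr 3
    ring
  have hscale : σ⁻¹ (-l) * ∑ w : κ, σ w * η ((1 + l * w) ^ 2 - 4 * w) =
      ∑ v : κ, σ v * η (l * (1 - v) ^ 2 + 4 * v) := by
    have hnl : -l ≠ 0 := neg_ne_zero.mpr hl0
    rw [Finset.mul_sum]
    refine Fintype.sum_equiv (Equiv.mulLeft₀ (-l) hnl) _ _ fun w => ?_
    simp only [Equiv.mulLeft₀_apply]
    have e : l * (1 - -l * w) ^ 2 + 4 * (-l * w) = l * ((1 + l * w) ^ 2 - 4 * w) := by ring
    have e1 : σ⁻¹ (-l) * σ (-l) = 1 := by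
      rw [MulChar.inv_apply', ← map_mul, inv_mul_cancel₀ hnl, map_one]
    have e2 : σ (-l) ^ 2 = η l := by
      rw [hσsq, neg_eq_neg_one_mul, map_mul, hneg, one_mul]
    have e3 : η l * η l = 1 := by rw [← map_mul, ← sq, apply_sq_eq_one hη2 hl0]
    rw [e, map_mul, map_mul η]
    linear_combination (σ w * η ((1 + l * w) ^ 2 - 4 * w)) *
      (-σ⁻¹ (-l) * e3 - σ⁻¹ (-l) * η l * e2 + σ (-l) * η l * e1)
  rw [Fh_eq_neg_sum hψ hσ1 (sub_ne_zero.mpr (Ne.symm hl1)), sub_sub_cancel, mul_neg,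
    sum_quartic_eq h2 hη2 hη1 hσ1 hl1, hscale, neg_inj]
  have hpal := two_mul_sum_palindromic h2 hη2 hη1 hση l
  rw [hrot, sum_joukowski h2 hη2 hη1 hneg] at hpal
  linear_combination (-1 / 2 : ℂ) * hpal - (∑ x : κ, η ((1 - x) * (1 - l * x ^ 2))) * hi2

end
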